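/- arXiv:1706.05074 — 2 statements merged into one kernel-verified Lean document; each statement's English description precedes it below -/
import Mathlib

section
/- The following limits inferior (as n → ∞, with log_n x = ln x / ln n) all equal liminf_n log_n R(M_n): liminf_n log_n R(sM^S_n), liminf_n log_n R_s(sM^S_n), liminf_n log_n R(sM^{S,0}_n), and liminf_n log_n R_s(sM^{S,0}_n). In other words, the exponent of matrix multiplication can be computed from the (symmetric) rank of the restriction of sM_n to symmetric matrices, or to traceless symmetric matrices. -/
open Filter Matrix

/-- Tensor rank of a trilinear form on a complex vector space `W`: the smallest `r`
such that `t(a,b,c) = ∑ i, f i a * g i b * h i c` for linear functionals `f i, g i, h i`. -/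
noncomputable def tensorRank {W : Type*} [AddCommGroup W] [Module ℂ W]
    (t : W → W → W → ℂ) : ℕ :=
  sInf {r : ℕ | ∃ f g h : Fin r → (W →ₗ[ℂ] ℂ),
    ∀ a b c, t a b c = ∑ i, f i a * g i b * h i c}

/-- Symmetric (Waring) rank of a cubic polynomial: the smallest `r` such that
`P = ℓ₁³ + ⋯ + ℓᵣ³` for linear forms `ℓᵢ`. -/
noncomputable def symRank {W : Type*} [AddCommGroup W] [Module ℂ W]
    (P : W → ℂ) : ℕ :=
  sInf {r : ℕ | ∃ ℓ : Fin r → (W →ₗ[ℂ] ℂ), ∀ a, P a = ∑ i, (ℓ i a) ^ 3}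

/-- The matrix multiplication tensor `M_n(A,B,C) = trace(ABC)`. -/
noncomputable def matMulTensor (n : ℕ) :
    Matrix (Fin n) (Fin n) ℂ → Matrix (Fin n) (Fin n) ℂ → Matrix (Fin n) (Fin n) ℂ → ℂ :=
  fun A B C => (A * B * C).trace

/-- The space of symmetric n×n complex matrices. -/
noncomputable def symMat (n : ℕ) : Submodule ℂ (Matrix (Fin n) (Fin n) ℂ) where
  carrier := {A | Aᵀ = A}
  add_mem' := by
    intro a b ha hb
    simp only [Set.mem_setOf_eq] at *
    rw [Matrix.transpose_add, ha, hb]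
  zero_mem' := by simp
  smul_mem' := by
    intro c A hA
    simp only [Set.mem_setOf_eq] at *
    rw [Matrix.transpose_smul, hA]

/-- `sM^S_n`: the restriction of `sM_n` to symmetric matrices. -/
noncomputable def sMS (n : ℕ) : symMat n → ℂ :=
  fun A => ((A : Matrix (Fin n) (Fin n) ℂ) ^ 3).trace

/-- The symmetric trilinear form (polarization) associated to `sM^S_n`. -/
noncomputable def sMSTensor (n : ℕ) : symMat n → symMat n → symMat n → ℂ :=
  fun A B C => (1/2 : ℂ) *
    (((A : Matrix (Fin n) (Fin n) ℂ) * B * C).trace +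
      ((B : Matrix (Fin n) (Fin n) ℂ) * A * C).trace)

/-- The space of traceless symmetric n×n complex matrices. -/
noncomputable def symMat0 (n : ℕ) : Submodule ℂ (Matrix (Fin n) (Fin n) ℂ) where
  carrier := {A | Aᵀ = A ∧ A.trace = 0}
  add_mem' := by
    intro a b ha hb
    simp only [Set.mem_setOf_eq] at *
    rw [Matrix.transpose_add, Matrix.trace_add, ha.1, hb.1, ha.2, hb.2]
    simp
  zero_mem' := by simp
  smul_mem' := by
    intro c A hA
    simp only [Set.mem_setOf_eq] at *
    rw [Matrix.transpose_smul, Matrix.trace_smul, hA.1, hA.2]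
    simp

/-- `sM^{S,0}_n`: the restriction of `sM_n` to traceless symmetric matrices. -/
noncomputable def sMS0 (n : ℕ) : symMat0 n → ℂ :=
  fun A => ((A : Matrix (Fin n) (Fin n) ℂ) ^ 3).trace

/-- The symmetric trilinear form (polarization) associated to `sM^{S,0}_n`. -/
noncomputable def sMS0Tensor (n : ℕ) : symMat0 n → symMat0 n → symMat0 n → ℂ :=
  fun A B C => (1/2 : ℂ) *
    (((A : Matrix (Fin n) (Fin n) ℂ) * B * C).trace +
      ((B : Matrix (Fin n) (Fin n) ℂ) * A * C).trace)

/-! ## Rank bounds from decompositions -/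

theorem tensorRank_le_of {W : Type*} [AddCommGroup W] [Module ℂ W] {t : W → W → W → ℂ}
    {ι : Type} [Fintype ι] (f g h : ι → (W →ₗ[ℂ] ℂ))
    (H : ∀ a b c, t a b c = ∑ i, f i a * g i b * h i c) :
    (∃ f g h : Fin (Fintype.card ι) → (W →ₗ[ℂ] ℂ),
      ∀ a b c, t a b c = ∑ i, f i a * g i b * h i c) ∧ tensorRank t ≤ Fintype.card ι := by
  have key : ∃ f g h : Fin (Fintype.card ι) → (W →ₗ[ℂ] ℂ),
      ∀ a b c, t a b c = ∑ i, f i a * g i b * h i c := by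
    refine ⟨f ∘ (Fintype.equivFin ι).symm, g ∘ (Fintype.equivFin ι).symm,
      h ∘ (Fintype.equivFin ι).symm, fun a b c => ?_⟩
    rw [H]
    exact ((Fintype.equivFin ι).symm.sum_comp (fun i => f i a * g i b * h i c)).symm
  exact ⟨key, Nat.sInf_le key⟩

theorem symRank_le_of {W : Type*} [AddCommGroup W] [Module ℂ W] {P : W → ℂ}
    {ι : Type} [Fintype ι] (f : ι → (W →ₗ[ℂ] ℂ))
    (H : ∀ a, P a = ∑ i, (f i a) ^ 3) :
    (∃ f : Fin (Fintype.card ι) → (W →ₗ[ℂ] ℂ), ∀ a, P a = ∑ i, (f i a) ^ 3) ∧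
      symRank P ≤ Fintype.card ι := by
  have key : ∃ f : Fin (Fintype.card ι) → (W →ₗ[ℂ] ℂ), ∀ a, P a = ∑ i, (f i a) ^ 3 := by
    refine ⟨f ∘ (Fintype.equivFin ι).symm, fun a => ?_⟩
    rw [H]
    exact ((Fintype.equivFin ι).symm.sum_comp (fun i => (f i a) ^ 3)).symm
  exact ⟨key, Nat.sInf_le key⟩

theorem matMul_bound (n : ℕ) :
    (∃ f g h : Fin (Fintype.card (Fin n × Fin n × Fin n)) → (Matrix (Fin n) (Fin n) ℂ →ₗ[ℂ] ℂ),
      ∀ a b c, matMulTensor n a b c = ∑ i, f i a * g i b * h i c) ∧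
    tensorRank (matMulTensor n) ≤ Fintype.card (Fin n × Fin n × Fin n) := by
  refine tensorRank_le_of (fun p => Matrix.entryLinearMap ℂ ℂ p.1 p.2.1)
    (fun p => Matrix.entryLinearMap ℂ ℂ p.2.1 p.2.2)
    (fun p => Matrix.entryLinearMap ℂ ℂ p.2.2 p.1) (fun a b c => ?_)
  simp only [matMulTensor, Matrix.trace, Matrix.diag, Matrix.mul_apply, Fintype.sum_prod_type,
    Matrix.entryLinearMap_apply, Finset.sum_mul]
  refine Finset.sum_congr rfl fun i _ => ?_
  rw [Finset.sum_comm]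

theorem matMul_attained (n : ℕ) :
    ∃ f g h : Fin (tensorRank (matMulTensor n)) → (Matrix (Fin n) (Fin n) ℂ →ₗ[ℂ] ℂ),
      ∀ a b c, matMulTensor n a b c = ∑ i, f i a * g i b * h i c :=
  Nat.sInf_mem (s := {r : ℕ | ∃ f g h : Fin r → (Matrix (Fin n) (Fin n) ℂ →ₗ[ℂ] ℂ),
    ∀ a b c, matMulTensor n a b c = ∑ i, f i a * g i b * h i c}) ⟨_, (matMul_bound n).1⟩

/-- Trace of the cube, on a subspace. -/
noncomputable def cubeOn {n : ℕ} (V : Submodule ℂ (Matrix (Fin n) (Fin n) ℂ)) : V → ℂ :=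
  fun A => ((A : Matrix (Fin n) (Fin n) ℂ) ^ 3).trace

/-- Polarization of the trace of the cube, on a subspace. -/
noncomputable def polOn {n : ℕ} (V : Submodule ℂ (Matrix (Fin n) (Fin n) ℂ)) :
    V → V → V → ℂ :=
  fun A B C => (1/2 : ℂ) *
    (((A : Matrix (Fin n) (Fin n) ℂ) * B * C).trace +
      ((B : Matrix (Fin n) (Fin n) ℂ) * A * C).trace)

theorem cubeOn_bound {n : ℕ} (V : Submodule ℂ (Matrix (Fin n) (Fin n) ℂ)) :
    (∃ r, ∃ f : Fin r → (V →ₗ[ℂ] ℂ), ∀ a, cubeOn V a = ∑ i, (f i a) ^ 3) ∧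
      symRank (cubeOn V) ≤ 4 * tensorRank (matMulTensor n) := by
  obtain ⟨f, g, h, H⟩ := matMul_attained n
  obtain ⟨z, hz⟩ := IsAlgClosed.exists_pow_nat_eq (1/24 : ℂ) (n := 3) (by norm_num)
  let ℓ : Fin 4 × Fin (tensorRank (matMulTensor n)) → (V →ₗ[ℂ] ℂ) := fun p =>
    (![z • (f p.2 + g p.2 + h p.2), -(z • (f p.2 + g p.2 - h p.2)),
      -(z • (f p.2 - g p.2 + h p.2)), -(z • (-f p.2 + g p.2 + h p.2))] p.1) ∘ₗ V.subtype
  have := symRank_le_of (P := cubeOn V) ℓ (fun a => by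
    have h1 : cubeOn V a = matMulTensor n a a a := by
      simp only [cubeOn, matMulTensor, pow_succ, pow_zero, one_mul]
    rw [h1, H, Fintype.sum_prod_type, Fin.sum_univ_four, ← Finset.sum_add_distrib,
      ← Finset.sum_add_distrib, ← Finset.sum_add_distrib]
    refine Finset.sum_congr rfl fun i _ => ?_
    simp [ℓ]
    generalize f i a = x
    generalize g i a = y
    generalize h i a = w
    linear_combination (-24 * x * y * w) * hz)
  refine ⟨⟨_, this.1⟩, this.2.trans ?_⟩
  simp

theorem polOn_le_cubeOn {n : ℕ} (V : Submodule ℂ (Matrix (Fin n) (Fin n) ℂ)) :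
    (∃ r, ∃ f g h : Fin r → (V →ₗ[ℂ] ℂ), ∀ a b c, polOn V a b c = ∑ i, f i a * g i b * h i c) ∧
      tensorRank (polOn V) ≤ symRank (cubeOn V) := by
  have hmem : ∃ f : Fin (symRank (cubeOn V)) → (V →ₗ[ℂ] ℂ), ∀ a, cubeOn V a = ∑ i, (f i a) ^ 3 :=
    Nat.sInf_mem (s := {r : ℕ | ∃ f : Fin r → (V →ₗ[ℂ] ℂ), ∀ a, cubeOn V a = ∑ i, (f i a) ^ 3})
      (cubeOn_bound V).1
  obtain ⟨f, hf⟩ := hmem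
  have := tensorRank_le_of (t := polOn V) f f f (fun a b c => by
    have h1 : polOn V a b c = (1/24 : ℂ) * (cubeOn V (a + b + c) - cubeOn V (a + b - c)
        - cubeOn V (a - b + c) - cubeOn V (-a + b + c)) := by
      simp only [polOn, cubeOn]
      push_cast
      generalize (a : Matrix (Fin n) (Fin n) ℂ) = A
      generalize (b : Matrix (Fin n) (Fin n) ℂ) = B
      generalize (c : Matrix (Fin n) (Fin n) ℂ) = C
      have e : (A + B + C)^3 - (A+B-C)^3 - (A-B+C)^3 - (-A+B+C)^3 =
        (4:ℂ) • (A*B*C + B*C*A + C*A*B + B*A*C + A*C*B + C*B*A) := by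
        have : ∀ M : Matrix (Fin n) (Fin n) ℂ, (4:ℂ) • M = M + M + M + M := by
          intro M; module
        rw [this]
        noncomm_ring
      rw [← Matrix.trace_sub, ← Matrix.trace_sub, ← Matrix.trace_sub, e]
      simp only [Matrix.trace_smul, Matrix.trace_add, smul_eq_mul]
      have c1 := Matrix.trace_mul_cycle A B C
      have c2 := Matrix.trace_mul_cycle C A B
      have c3 := Matrix.trace_mul_cycle B A C
      have c4 := Matrix.trace_mul_cycle C B A
      linear_combination (1/3 : ℂ) * c1 + (1/6 : ℂ) * c2 + (1/3 : ℂ) * c3 + (1/6 : ℂ) * c4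
    rw [h1, hf, hf, hf, hf, ← Finset.sum_sub_distrib, ← Finset.sum_sub_distrib,
      ← Finset.sum_sub_distrib, Finset.mul_sum]
    refine Finset.sum_congr rfl fun i _ => ?_
    simp only [map_add, map_sub, map_neg]
    ring)
  refine ⟨⟨_, this.1⟩, this.2.trans ?_⟩
  simp

/-! ## Embedding matrix multiplication -/

theorem exists_blocks {k n : ℕ} (h : 3 * k ≤ n) :
    ∃ P : Fin 3 → Matrix (Fin k) (Fin n) ℂ,
      (∀ a, P a * (P a)ᵀ = 1) ∧ ∀ a b, a ≠ b → P a * (P b)ᵀ = 0 := by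
  let e : Fin 3 → Fin k → Fin n := fun a p =>
    ⟨a * k + p, by
      have h1 := p.2
      have h2 : (a : ℕ) * k ≤ 2 * k := Nat.mul_le_mul_right _ (by omega)
      omega⟩
  have he : ∀ a b p q, e a p = e b q ↔ a = b ∧ p = q := by
    intro a b p q
    refine ⟨fun H => ?_, fun H => by rw [H.1, H.2]⟩
    have H' : (a : ℕ) * k + p = b * k + q := congrArg Fin.val H
    have hp := p.2
    have hq := q.2
    have hk : 0 < k := by omega
    have d1 : ((a : ℕ) * k + p) / k = a := by
      rw [mul_comm, Nat.mul_add_div hk, Nat.div_eq_of_lt hp, add_zero]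
    have d2 : ((b : ℕ) * k + q) / k = b := by
      rw [mul_comm, Nat.mul_add_div hk, Nat.div_eq_of_lt hq, add_zero]
    have hab : (a : ℕ) = b := by rw [← d1, ← d2, H']
    rw [hab] at H'
    exact ⟨Fin.ext hab, Fin.ext (by omega)⟩
  let P : Fin 3 → Matrix (Fin k) (Fin n) ℂ := fun a => Matrix.of fun p q => if e a p = q then 1 else 0
  refine ⟨P, fun a => ?_, fun a b hab => ?_⟩
  · ext p q
    simp [P, Matrix.mul_apply, Matrix.one_apply, he, eq_comm]
  · ext p q
    simp [P, Matrix.mul_apply, he, hab, Ne.symm hab]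

theorem matMul_le_polOn {k n : ℕ} (h : 3 * k ≤ n)
    (V : Submodule ℂ (Matrix (Fin n) (Fin n) ℂ)) (hV : symMat0 n ≤ V) :
    tensorRank (matMulTensor k) ≤ tensorRank (polOn V) := by
  obtain ⟨P, h1, h0⟩ := exists_blocks h
  let E : Fin 3 → Fin 3 → Matrix (Fin k) (Fin k) ℂ →ₗ[ℂ] Matrix (Fin n) (Fin n) ℂ := fun a b =>
    { toFun := fun A => (P a)ᵀ * A * P b + (P b)ᵀ * Aᵀ * P a
      map_add' := fun A B => by
        simp only [Matrix.transpose_add, Matrix.mul_add, Matrix.add_mul]; abel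
      map_smul' := fun c A => by
        simp [Matrix.transpose_smul, smul_add] }
  have hE : ∀ a b A, E a b A = (P a)ᵀ * A * P b + (P b)ᵀ * Aᵀ * P a := fun _ _ _ => rfl
  have hmem : ∀ a b, a ≠ b → ∀ A, E a b A ∈ V := by
    intro a b hab A
    refine hV ⟨?_, ?_⟩
    · rw [hE]
      simp only [Matrix.transpose_add, Matrix.transpose_mul, Matrix.transpose_transpose,
        Matrix.mul_assoc]
      rw [add_comm]
    · rw [hE, Matrix.trace_add, Matrix.trace_mul_comm, ← Matrix.mul_assoc, h0 _ _ hab.symm,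
        Matrix.trace_mul_comm ((P b)ᵀ * Aᵀ), ← Matrix.mul_assoc, h0 _ _ hab]
      simp
  let F : ∀ a b : Fin 3, a ≠ b → (Matrix (Fin k) (Fin k) ℂ →ₗ[ℂ] V) := fun a b hab =>
    (E a b).codRestrict V (hmem a b hab)
  have hF : ∀ a b hab A, ((F a b hab A : V) : Matrix (Fin n) (Fin n) ℂ) = E a b A :=
    fun _ _ _ _ => rfl
  have n01 : (0 : Fin 3) ≠ 1 := by decide
  have n12 : (1 : Fin 3) ≠ 2 := by decide
  have n20 : (2 : Fin 3) ≠ 0 := by decide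
  have key : ∀ A B C, matMulTensor k A B C = polOn V (F 0 1 n01 A) (F 1 2 n12 B) (F 2 0 n20 C) := by
    intro A B C
    have q1 : ∀ a (M : Matrix (Fin k) (Fin n) ℂ), P a * ((P a)ᵀ * M) = M := fun a M => by
      rw [← Matrix.mul_assoc, h1, Matrix.one_mul]
    have q0 : ∀ a b, a ≠ b → ∀ (M : Matrix (Fin k) (Fin n) ℂ), P a * ((P b)ᵀ * M) = 0 :=
      fun a b hab M => by rw [← Matrix.mul_assoc, h0 a b hab, Matrix.zero_mul]
    have e1 : E 0 1 A * E 1 2 B * E 2 0 C = (P 0)ᵀ * (A * B * C * P 0) := by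
      simp only [hE, Matrix.mul_add, Matrix.add_mul, Matrix.mul_assoc, q1,
        q0 0 1 n01, q0 1 2 n12, q0 2 0 n20, q0 1 0 n01.symm, q0 2 1 n12.symm, q0 0 2 n20.symm,
        Matrix.mul_zero, add_zero, zero_add]
    have e2 : E 1 2 B * E 0 1 A * E 2 0 C = (P 2)ᵀ * (Bᵀ * Aᵀ * Cᵀ * P 2) := by
      simp only [hE, Matrix.mul_add, Matrix.add_mul, Matrix.mul_assoc, q1,
        q0 0 1 n01, q0 1 2 n12, q0 2 0 n20, q0 1 0 n01.symm, q0 2 1 n12.symm, q0 0 2 n20.symm,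
        Matrix.mul_zero, add_zero, zero_add]
    have t2 : (Bᵀ * Aᵀ * Cᵀ).trace = (A * B * C).trace := by
      rw [← Matrix.transpose_mul, ← Matrix.transpose_mul, Matrix.trace_transpose,
        Matrix.trace_mul_comm]
    simp only [polOn, matMulTensor, hF]
    rw [e1, e2, Matrix.trace_mul_comm (P 0)ᵀ, Matrix.mul_assoc _ (P 0), h1, Matrix.mul_one,
      Matrix.trace_mul_comm (P 2)ᵀ, Matrix.mul_assoc _ (P 2), h1, Matrix.mul_one, t2]
    ring
  have hatt : ∃ f g h : Fin (tensorRank (polOn V)) → (V →ₗ[ℂ] ℂ),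
      ∀ a b c, polOn V a b c = ∑ i, f i a * g i b * h i c :=
    Nat.sInf_mem (s := {r : ℕ | ∃ f g h : Fin r → (V →ₗ[ℂ] ℂ),
      ∀ a b c, polOn V a b c = ∑ i, f i a * g i b * h i c}) (polOn_le_cubeOn V).1
  obtain ⟨f, g, h, H⟩ := hatt
  refine Nat.sInf_le ⟨fun i => f i ∘ₗ F 0 1 n01, fun i => g i ∘ₗ F 1 2 n12,
    fun i => h i ∘ₗ F 2 0 n20, fun a b c => ?_⟩
  rw [key, H]
  rfl

/-! ## Limits inferior -/

theorem liminf_le_liminf_aux (u v ε : ℕ → ℝ) (φ : ℕ → ℕ) (K : ℝ)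
    (hu0 : ∀ n, 0 ≤ u n) (hv0 : ∀ n, 0 ≤ v n) (hv : ∀ n, v n ≤ K)
    (hφ : Tendsto φ atTop atTop) (hε : Tendsto ε atTop (nhds 0))
    (h : ∀ᶠ n in atTop, u (φ n) ≤ v n + ε n) :
    liminf u atTop ≤ liminf v atTop := by
  have hub : IsBoundedUnder (· ≥ ·) atTop u := isBoundedUnder_of ⟨0, hu0⟩
  have hvc : IsCoboundedUnder (· ≥ ·) atTop v :=
    (isBoundedUnder_of ⟨K, hv⟩ : IsBoundedUnder (· ≤ ·) atTop v).isCoboundedUnder_ge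
  refine le_of_forall_pos_sub_le fun δ hδ => ?_
  refine le_liminf_of_le hvc ?_
  have h1 : ∀ᶠ n in atTop, liminf u atTop - δ / 2 < u n :=
    eventually_lt_of_lt_liminf (by linarith) hub
  filter_upwards [hφ.eventually h1, h, hε.eventually (gt_mem_nhds (half_pos hδ))] with n a b c
  linarith

theorem log_ratio_bound (X : ℕ → ℕ) (hX : ∀ n, X n ≤ 4 * n ^ 3) (n : ℕ) :
    Real.log (X n) / Real.log n ≤ 5 := by
  rcases Nat.lt_or_ge n 2 with hn | hn
  · interval_cases n <;> simp
  · have hn' : (2 : ℝ) ≤ n := by exact_mod_cast hn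
    have hl : 0 < Real.log n := Real.log_pos (by linarith)
    rw [div_le_iff₀ hl]
    rcases Nat.eq_zero_or_pos (X n) with h0 | h0
    · rw [h0]; simp; positivity
    · have h1 : (X n : ℝ) ≤ (n : ℝ) ^ 5 := by
        have : (X n : ℝ) ≤ 4 * (n : ℝ) ^ 3 := by exact_mod_cast hX n
        have h3 : (0 : ℝ) < (n : ℝ) ^ 3 := by positivity
        have h4 : (4 : ℝ) ≤ (n : ℝ) ^ 2 := by nlinarith
        calc (X n : ℝ) ≤ 4 * (n : ℝ) ^ 3 := this
          _ ≤ (n : ℝ) ^ 2 * (n : ℝ) ^ 3 := mul_le_mul_of_nonneg_right h4 h3.le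
          _ = (n : ℝ) ^ 5 := by ring
      calc Real.log (X n) ≤ Real.log ((n : ℝ) ^ 5) :=
            Real.log_le_log (by exact_mod_cast h0) h1
        _ = 5 * Real.log n := by rw [Real.log_pow]; norm_num

theorem log_ratio_nonneg (X : ℕ → ℕ) (n : ℕ) : 0 ≤ Real.log (X n) / Real.log n :=
  div_nonneg (Real.log_natCast_nonneg _) (Real.log_natCast_nonneg _)

theorem log_natCast_mono {a b : ℕ} (h : a ≤ b) : Real.log a ≤ Real.log b := by
  rcases Nat.eq_zero_or_pos a with h0 | h0
  · rw [h0]; simpa using Real.log_natCast_nonneg b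
  · exact Real.log_le_log (by exact_mod_cast h0) (by exact_mod_cast h)

theorem tendsto_const_div_log (c : ℝ) :
    Tendsto (fun n : ℕ => c / Real.log n) atTop (nhds 0) :=
  tendsto_const_nhds.div_atTop (Real.tendsto_log_atTop.comp tendsto_natCast_atTop_atTop)

theorem liminf_eq_aux (T X : ℕ → ℕ) (hT : ∀ n, T n ≤ n ^ 3)
    (h1 : ∀ n, X n ≤ 4 * T n) (h2 : ∀ n, T (n / 3) ≤ X n) :
    liminf (fun n : ℕ => Real.log (T n) / Real.log n) atTop =
      liminf (fun n : ℕ => Real.log (X n) / Real.log n) atTop := by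
  have hT4 : ∀ n, T n ≤ 4 * n ^ 3 := fun n => (hT n).trans (by omega)
  have hX4 : ∀ n, X n ≤ 4 * n ^ 3 := fun n => (h1 n).trans (Nat.mul_le_mul_left _ (hT n))
  apply le_antisymm
  · refine liminf_le_liminf_aux _ _ (fun n => (5 * Real.log 6) / Real.log n) (fun n => n / 3) 5
      (log_ratio_nonneg T) (log_ratio_nonneg X) (log_ratio_bound X hX4) ?_
      (tendsto_const_div_log _) ?_
    · exact Nat.tendsto_div_const_atTop (by norm_num)
    · filter_upwards [eventually_ge_atTop 6] with n hn
      have hk2 : 2 ≤ n / 3 := by omega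
      have hk : n ≤ 6 * (n / 3) := by omega
      generalize hkk : n / 3 = k at *
      have hln : 0 < Real.log n := Real.log_pos (by exact_mod_cast (by omega : 1 < n))
      have hlk : 0 < Real.log k := Real.log_pos (by exact_mod_cast (by omega : 1 < k))
      have hb := log_ratio_bound T hT4 k
      have hr0 := log_ratio_nonneg T k
      have hle : Real.log (T k) ≤ Real.log (X n) := by
        have := h2 n
        rw [hkk] at this
        exact log_natCast_mono this
      have hnk : Real.log n ≤ Real.log 6 + Real.log k := by
        rw [← Real.log_mul (by norm_num) (by positivity)]
        exact_mod_cast log_natCast_mono hk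
      have hx : Real.log (T k) = (Real.log (T k) / Real.log k) * Real.log k := by
        field_simp
      rw [← add_div, le_div_iff₀ hln]
      have h6 : 0 ≤ Real.log 6 := Real.log_nonneg (by norm_num)
      generalize Real.log (T k) / Real.log k = r at *
      nlinarith [mul_le_mul_of_nonneg_left hnk hr0, mul_le_mul_of_nonneg_right hb h6]
  · refine liminf_le_liminf_aux _ _ (fun n => (Real.log 4) / Real.log n) (fun n => n) 5
      (log_ratio_nonneg X) (log_ratio_nonneg T) (log_ratio_bound T hT4) tendsto_id
      (tendsto_const_div_log _) ?_
    filter_upwards [eventually_ge_atTop 2] with n hn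
    have hln : 0 < Real.log n := Real.log_pos (by exact_mod_cast (by omega : 1 < n))
    rw [← add_div]
    refine div_le_div_of_nonneg_right ?_ hln.le
    rcases Nat.eq_zero_or_pos (T n) with h0 | h0
    · have : X n = 0 := by have := h1 n; omega
      rw [this, h0]
      simpa using Real.log_nonneg (by norm_num : (1 : ℝ) ≤ 4)
    · have hT0 : (T n : ℝ) ≠ 0 := by exact_mod_cast h0.ne'
      rw [add_comm, ← Real.log_mul (by norm_num) hT0]
      exact_mod_cast log_natCast_mono (h1 n)

theorem matMul_le_cube (n : ℕ) : tensorRank (matMulTensor n) ≤ n ^ 3 := by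
  refine (matMul_bound n).2.trans (le_of_eq ?_)
  simp
  ring

theorem liminf_pol (V : ∀ n, Submodule ℂ (Matrix (Fin n) (Fin n) ℂ)) (hV : ∀ n, symMat0 n ≤ V n) :
    liminf (fun n : ℕ => Real.log (tensorRank (matMulTensor n)) / Real.log n) atTop =
      liminf (fun n : ℕ => Real.log (tensorRank (polOn (V n))) / Real.log n) atTop :=
  liminf_eq_aux (fun n => tensorRank (matMulTensor n)) (fun n => tensorRank (polOn (V n)))
    matMul_le_cube (fun n => (polOn_le_cubeOn (V n)).2.trans (cubeOn_bound (V n)).2)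
    (fun n => matMul_le_polOn (by omega) (V n) (hV n))

theorem liminf_cube (V : ∀ n, Submodule ℂ (Matrix (Fin n) (Fin n) ℂ))
    (hV : ∀ n, symMat0 n ≤ V n) :
    liminf (fun n : ℕ => Real.log (tensorRank (matMulTensor n)) / Real.log n) atTop =
      liminf (fun n : ℕ => Real.log (symRank (cubeOn (V n))) / Real.log n) atTop :=
  liminf_eq_aux (fun n => tensorRank (matMulTensor n)) (fun n => symRank (cubeOn (V n)))
    matMul_le_cube (fun n => (cubeOn_bound (V n)).2)
    (fun n => (matMul_le_polOn (by omega) (V n) (hV n)).trans (polOn_le_cubeOn (V n)).2)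

theorem liminf_log_rank_sMS_eq :
    Filter.liminf (fun n : ℕ => Real.log (tensorRank (matMulTensor n)) / Real.log n) atTop =
      Filter.liminf (fun n : ℕ => Real.log (tensorRank (sMSTensor n)) / Real.log n) atTop ∧
    Filter.liminf (fun n : ℕ => Real.log (tensorRank (matMulTensor n)) / Real.log n) atTop =
      Filter.liminf (fun n : ℕ => Real.log (symRank (sMS n)) / Real.log n) atTop ∧
    Filter.liminf (fun n : ℕ => Real.log (tensorRank (matMulTensor n)) / Real.log n) atTop =
      Filter.liminf (fun n : ℕ => Real.log (tensorRank (sMS0Tensor n)) / Real.log n) atTop ∧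
    Filter.liminf (fun n : ℕ => Real.log (tensorRank (matMulTensor n)) / Real.log n) atTop =
      Filter.liminf (fun n : ℕ => Real.log (symRank (sMS0 n)) / Real.log n) atTop := by
  have hle : ∀ n, symMat0 n ≤ symMat n := fun n A hA => hA.1
  exact ⟨liminf_pol symMat hle, liminf_cube symMat hle, liminf_pol symMat0 fun _ => le_rfl,
    liminf_cube symMat0 fun _ => le_rfl⟩
end

section
/- The symmetric border rank of sM^S_3 equals 10: the cubic polynomial sM^S_3 on the 6-dimensional space of symmetric 3×3 complex matrices lies in the closure of the set of cubics of symmetric rank at most 10, but does not lie in the closure of the set of cubics of symmetric rank at most 9. -/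
open Filter Matrix

/-- Symmetric border rank of a cubic polynomial: the smallest `r` such that `P` is a
limit of cubics of symmetric rank at most `r` (pointwise convergence, which on the
finite-dimensional space of cubics agrees with the usual topology). -/
noncomputable def symBorderRank {W : Type*} [AddCommGroup W] [Module ℂ W]
    (P : W → ℂ) : ℕ :=
  sInf {r : ℕ | ∃ ℓ : ℕ → Fin r → (W →ₗ[ℂ] ℂ),
    ∀ a, Tendsto (fun m => ∑ i, (ℓ m i a) ^ 3) atTop (nhds (P a))}

noncomputable section

def kSgn : Matrix (Fin 10) (Fin 10) ℂ :=
  !![0, 0, 0, 0, 0, 0, 0, 1, -1, 1;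
     0, 0, 0, 0, 0, -1, 1, 0, 0, -1;
     0, 0, 0, 0, 1, 0, -1, 0, 1, 0;
     0, 0, 0, 0, -1, 1, 0, -1, 0, 0;
     0, 0, 1, -1, 0, 0, 0, 0, 0, 1;
     0, -1, 0, 1, 0, 0, 0, 0, -1, 0;
     0, 1, -1, 0, 0, 0, 0, 1, 0, 0;
     1, 0, 0, -1, 0, 0, 1, 0, 0, 0;
     -1, 0, 1, 0, 0, -1, 0, 0, 0, 0;
     1, -1, 0, 0, 1, 0, 0, 0, 0, 0]

def kIdx : Matrix (Fin 10) (Fin 10) (Fin 5) :=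
  !![0, 0, 0, 0, 0, 0, 0, 4, 3, 2;
     0, 0, 0, 0, 0, 4, 3, 0, 0, 1;
     0, 0, 0, 0, 4, 0, 2, 0, 1, 0;
     0, 0, 0, 0, 3, 2, 0, 1, 0, 0;
     0, 0, 4, 3, 0, 0, 0, 0, 0, 0;
     0, 4, 0, 2, 0, 0, 0, 0, 0, 0;
     0, 3, 2, 0, 0, 0, 0, 0, 0, 0;
     4, 0, 0, 1, 0, 0, 0, 0, 0, 0;
     3, 0, 1, 0, 0, 0, 0, 0, 0, 0;
     2, 1, 0, 0, 0, 0, 0, 0, 0, 0]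

def pIdx : Fin 10 → Fin 5 := ![0, 0, 0, 0, 1, 1, 1, 2, 2, 3]

def qIdx : Fin 10 → Fin 5 := ![1, 2, 3, 4, 2, 3, 4, 3, 4, 4]

def uVec : Fin 5 → Fin 6 → ℂ :=
  ![![1, -1, 0, 0, 0, 0],
    ![0, 1, 1, 0, 0, 0],
    ![0, 0, 0, 1, 0, 0],
    ![0, 0, 0, 0, 1, 0],
    ![0, 0, 0, 0, 0, 1]]

def tTab : Fin 5 → Matrix (Fin 6) (Fin 6) ℂ :=
  ![!![2, 0, 0, 0, 0, 0;
     0, -2, 0, 0, 0, 0;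
     0, 0, 0, 0, 0, 0;
     0, 0, 0, 0, 0, 0;
     0, 0, 0, 0, 2, 0;
     0, 0, 0, 0, 0, -2],
    !![0, 0, 0, 0, 0, 0;
     0, 2, 0, 0, 0, 0;
     0, 0, 2, 0, 0, 0;
     0, 0, 0, 2, 0, 0;
     0, 0, 0, 0, 2, 0;
     0, 0, 0, 0, 0, 4],
    !![0, 0, 0, 2, 0, 0;
     0, 0, 0, 2, 0, 0;
     0, 0, 0, 0, 0, 0;
     2, 2, 0, 0, 0, 0;
     0, 0, 0, 0, 0, 2;
     0, 0, 0, 0, 2, 0],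
    !![0, 0, 0, 0, 2, 0;
     0, 0, 0, 0, 0, 0;
     0, 0, 0, 0, 2, 0;
     0, 0, 0, 0, 0, 2;
     2, 0, 2, 0, 0, 0;
     0, 0, 0, 2, 0, 0],
    !![0, 0, 0, 0, 0, 0;
     0, 0, 0, 0, 0, 2;
     0, 0, 0, 0, 0, 2;
     0, 0, 0, 0, 2, 0;
     0, 0, 0, 2, 0, 0;
     0, 2, 2, 0, 0, 0]]

def rSet : Finset (Fin 10 × Fin 6) := {(3, 5), (6, 5), (4, 2), (2, 1), (3, 0)}

def rTab : Matrix (Fin 10) (Fin 6) ℂ := fun i a => if (i, a) ∈ rSet then 1 else 0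

set_option maxHeartbeats 4000000 in
theorem inj_aux (f : Fin 10 × Fin 6 → ℂ)
    (H : ∀ i a, (∑ j, ∑ b, kSgn i j * tTab (kIdx i j) a b * f (j, b)) + rTab i a * f (i, a) = 0) :
    f = 0 := by
  have e0 := H 0 0
  have e1 := H 0 1
  have e2 := H 0 2
  have e3 := H 0 3
  have e4 := H 0 4
  have e5 := H 0 5
  have e6 := H 1 0
  have e7 := H 1 1
  have e8 := H 1 2
  have e9 := H 1 3
  have e10 := H 1 4
  have e11 := H 1 5
  have e12 := H 2 0
  have e13 := H 2 1
  have e14 := H 2 2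
  have e15 := H 2 3
  have e16 := H 2 4
  have e17 := H 2 5
  have e18 := H 3 0
  have e19 := H 3 1
  have e20 := H 3 2
  have e21 := H 3 3
  have e22 := H 3 4
  have e23 := H 3 5
  have e24 := H 4 0
  have e25 := H 4 1
  have e26 := H 4 2
  have e27 := H 4 3
  have e28 := H 4 4
  have e29 := H 4 5
  have e30 := H 5 0
  have e31 := H 5 1
  have e32 := H 5 2
  have e33 := H 5 3
  have e34 := H 5 4
  have e35 := H 5 5
  have e36 := H 6 0
  have e37 := H 6 1
  have e38 := H 6 2
  have e39 := H 6 3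
  have e40 := H 6 4
  have e41 := H 6 5
  have e42 := H 7 0
  have e43 := H 7 1
  have e44 := H 7 2
  have e45 := H 7 3
  have e46 := H 7 4
  have e47 := H 7 5
  have e48 := H 8 0
  have e49 := H 8 1
  have e50 := H 8 2
  have e51 := H 8 3
  have e52 := H 8 4
  have e53 := H 8 5
  have e54 := H 9 0
  have e55 := H 9 1
  have e56 := H 9 2
  have e57 := H 9 3
  have e58 := H 9 4
  have e59 := H 9 5
  simp [Fin.sum_univ_succ, kSgn, kIdx, tTab, rTab, rSet] at e0 e1 e2 e3 e4 e5 e6 e7 e8 e9 e10 e11 e12 e13 e14 e15 e16 e17 e18 e19 e20 e21 e22 e23 e24 e25 e26 e27 e28 e29 e30 e31 e32 e33 e34 e35 e36 e37 e38 e39 e40 e41 e42 e43 e44 e45 e46 e47 e48 e49 e50 e51 e52 e53 e54 e55 e56 e57 e58 e59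
  funext ⟨i, a⟩
  fin_cases i <;> fin_cases a
  · change f (0, 0) = 0
    linear_combination (5/4) * e0 + (-1) * e1 + (1/4) * e9 + (-3/4) * e27 + (-5/4) * e34 + (-1) * e41 + (-1/4) * e47 + (-1/4) * e52 + (1/4) * e57
  · change f (0, 1) = 0
    linear_combination (-1) * e0 + (7/4) * e1 + (5/4) * e2 + (3/4) * e9 + (1) * e16 + (1) * e23 + (3/4) * e27 + (3/4) * e34 + (1) * e41 + (1/4) * e47 + (1/4) * e52 + (1/4) * e57
  · change f (0, 2) = 0
    linear_combination (5/4) * e1 + (3/4) * e2 + (5/4) * e9 + (1) * e16 + (1) * e23 + (1/4) * e27 + (1/4) * e34 + (1/4) * e47 + (-1/4) * e52 + (-1/4) * e57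
  · change f (0, 3) = 0
    linear_combination (1/4) * e3 + (1/2) * e6 + (1/4) * e7 + (1/4) * e17 + (1/4) * e22 + (-1/4) * e24 + (-1/4) * e35 + (1/4) * e54 + (1/4) * e55 + (-1/2) * e56
  · change f (0, 4) = 0
    linear_combination (-1/4) * e4 + (-1/4) * e14 + (-1/4) * e21 + (-1/4) * e29 + (1/4) * e30 + (1/2) * e45 + (-1/4) * e48 + (1/4) * e49 + (1/4) * e50
  · change f (0, 5) = 0
    linear_combination (-1/4) * e5 + (-1/4) * e15 + (-1/4) * e20 + (1/4) * e28 + (1/4) * e33 + (-1/4) * e37 + (1/2) * e38 + (-1/2) * e42 + (1/4) * e43 + (-1/4) * e44 + (-1/2) * e51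
  · change f (1, 0) = 0
    linear_combination (1/4) * e3 + (5/2) * e6 + (3/4) * e7 + (1/4) * e17 + (3/4) * e22 + (-1/4) * e24 + (-1/2) * e25 + (1) * e26 + (-1/4) * e35 + (1/2) * e40 + (-1) * e46 + (3/4) * e54 + (1/4) * e55 + (-3/2) * e56
  · change f (1, 1) = 0
    linear_combination (1/4) * e3 + (3/2) * e6 + (5/4) * e7 + (3/4) * e17 + (1/4) * e22 + (-1/4) * e24 + (-1) * e25 + (-1) * e26 + (-5/4) * e35 + (1) * e53 + (1/4) * e54 + (3/4) * e55 + (-5/2) * e56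
  · change f (1, 2) = 0
    linear_combination (1) * e56
  · change f (1, 3) = 0
    linear_combination (1/4) * e0 + (3/4) * e1 + (5/4) * e2 + (1) * e9 + (1) * e16 + (1) * e23 + (-1/2) * e34
  · change f (1, 4) = 0
    linear_combination (1) * e38
  · change f (1, 5) = 0
    linear_combination (1) * e32
  · change f (2, 0) = 0
    linear_combination (-2) * e12 + (-1) * e13 + (1) * e31 + (-1) * e32 + (-1/2) * e39 + (1) * e45 + (-1) * e59
  · change f (2, 1) = 0
    linear_combination (2) * e12 + (1) * e13 + (-1) * e31 + (2) * e32 + (-1) * e45 + (1) * e59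
  · change f (2, 2) = 0
    linear_combination (-1/4) * e4 + (-1/4) * e14 + (-1/4) * e21 + (-1/4) * e29 + (1/4) * e30 + (1/2) * e45 + (-1/4) * e48 + (1/4) * e49 + (3/4) * e50
  · change f (2, 3) = 0
    linear_combination (-1/4) * e5 + (-1/4) * e15 + (-1/4) * e20 + (1/4) * e28 + (1/4) * e33 + (-1/4) * e37 + (1/2) * e38 + (-1/2) * e42 + (1/4) * e43 + (-1/4) * e44
  · change f (2, 4) = 0
    linear_combination (1) * e1 + (1) * e2 + (1) * e9 + (1) * e16 + (1) * e23 + (1/2) * e27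
  · change f (2, 5) = 0
    linear_combination (1/4) * e3 + (1/2) * e6 + (3/4) * e7 + (1/4) * e17 + (1/4) * e22 + (-1/4) * e24 + (-1/2) * e25 + (-1/4) * e35 + (1/2) * e53 + (1/4) * e54 + (1/4) * e55 + (-1/2) * e56
  · change f (3, 0) = 0
    linear_combination (1) * e18 + (-1) * e19 + (1) * e37 + (2) * e38 + (1) * e51 + (1) * e58
  · change f (3, 1) = 0
    linear_combination (-1) * e18 + (1) * e19 + (1/2) * e33 + (-1) * e37 + (-1) * e38 + (-1) * e51 + (-1) * e58
  · change f (3, 2) = 0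
    linear_combination (-1/4) * e5 + (-1/4) * e15 + (-1/4) * e20 + (1/4) * e28 + (1/4) * e33 + (-1/4) * e37 + (1/2) * e38 + (-1/2) * e42 + (1/4) * e43 + (-3/4) * e44 + (-1/2) * e51
  · change f (3, 3) = 0
    linear_combination (-1/4) * e4 + (-1/4) * e14 + (-1/4) * e21 + (-1/4) * e29 + (1/4) * e30 + (-1/4) * e48 + (1/4) * e49 + (1/4) * e50
  · change f (3, 4) = 0
    linear_combination (1/4) * e3 + (3/2) * e6 + (1/4) * e7 + (1/4) * e17 + (1/4) * e22 + (-1/4) * e24 + (-1/4) * e35 + (-1/2) * e46 + (1/4) * e54 + (1/4) * e55 + (-1/2) * e56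
  · change f (3, 5) = 0
    linear_combination (1) * e1 + (1) * e2 + (1) * e9 + (1) * e16 + (1) * e23
  · change f (4, 0) = 0
    linear_combination (-1/4) * e3 + (-1/2) * e6 + (-1/4) * e7 + (-1/4) * e17 + (-1/4) * e22 + (1/4) * e24 + (1/4) * e35 + (1/4) * e54 + (-1/4) * e55 + (1/2) * e56
  · change f (4, 1) = 0
    linear_combination (-1) * e6 + (-1) * e7 + (-1/2) * e17 + (1) * e25 + (1) * e26 + (1) * e35 + (-1) * e53 + (-1) * e55 + (2) * e56
  · change f (4, 2) = 0
    linear_combination (2) * e6 + (-1) * e7 + (1) * e25 + (1) * e26 + (-1) * e46 + (-1) * e53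
  · change f (4, 3) = 0
    linear_combination (-3/4) * e0 + (3/4) * e1 + (1/4) * e2 + (1/2) * e16 + (1) * e27 + (1) * e34 + (1) * e41
  · change f (4, 4) = 0
    linear_combination (1/4) * e5 + (1/4) * e15 + (1/4) * e20 + (-1/4) * e28 + (-1/4) * e33 + (1/4) * e37 + (1/2) * e38 + (1/2) * e42 + (-1/4) * e43 + (1/4) * e44 + (1/2) * e51 + (1/2) * e58
  · change f (4, 5) = 0
    linear_combination (-1/4) * e4 + (-1/4) * e14 + (-1/4) * e21 + (-1/4) * e29 + (1/4) * e30 + (-2) * e32 + (1/2) * e45 + (-1/4) * e48 + (1/4) * e49 + (1/4) * e50 + (-1/2) * e59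
  · change f (5, 0) = 0
    linear_combination (1/4) * e4 + (1/4) * e14 + (1/4) * e21 + (1/4) * e29 + (-1/4) * e30 + (-1/2) * e45 + (-1/4) * e48 + (-1/4) * e49 + (-1/4) * e50
  · change f (5, 1) = 0
    linear_combination (-2) * e12 + (-1) * e13 + (1) * e31 + (-2) * e32 + (1) * e45 + (1/2) * e49 + (-1) * e59
  · change f (5, 2) = 0
    linear_combination (-1/2) * e11 + (-1) * e12 + (-1) * e13 + (1) * e29 + (1) * e31 + (-2) * e32 + (-1/2) * e49 + (-1) * e50 + (-1) * e59
  · change f (5, 3) = 0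
    linear_combination (1/4) * e5 + (1/4) * e15 + (1/2) * e19 + (1/4) * e20 + (-1/4) * e28 + (-1/4) * e33 + (-1/4) * e37 + (-1/2) * e38 + (1/2) * e42 + (-1/4) * e43 + (1/4) * e44
  · change f (5, 4) = 0
    linear_combination (-5/4) * e0 + (3/4) * e1 + (1/4) * e2 + (-1/2) * e9 + (1) * e27 + (1) * e34 + (1) * e41
  · change f (5, 5) = 0
    linear_combination (-1/4) * e3 + (-1/2) * e6 + (-5/4) * e7 + (-1/4) * e17 + (-1/4) * e22 + (1/4) * e24 + (1) * e25 + (1/4) * e35 + (-1/2) * e53 + (-1/4) * e54 + (-1/4) * e55 + (1/2) * e56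
  · change f (6, 0) = 0
    linear_combination (1) * e42
  · change f (6, 1) = 0
    linear_combination (-1/4) * e5 + (-1/4) * e15 + (1) * e18 + (-1) * e19 + (-1/4) * e20 + (1/4) * e28 + (-1/4) * e33 + (3/4) * e37 + (3/2) * e38 + (-1/2) * e42 + (-1/4) * e43 + (-1/4) * e44 + (1/2) * e51 + (1) * e58
  · change f (6, 2) = 0
    linear_combination (1/4) * e5 + (1/2) * e10 + (1/4) * e15 + (1) * e18 + (-1/2) * e19 + (1/4) * e20 + (1/4) * e28 + (-1/4) * e33 + (3/4) * e37 + (3/2) * e38 + (-1/2) * e42 + (-1/4) * e43 + (-1/4) * e44 + (1/2) * e51 + (1) * e58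
  · change f (6, 3) = 0
    linear_combination (1) * e12
  · change f (6, 4) = 0
    linear_combination (1) * e6
  · change f (6, 5) = 0
    linear_combination (-1) * e0 + (1) * e1 + (1) * e27 + (1) * e34 + (1) * e41
  · change f (7, 0) = 0
    linear_combination (-1/4) * e5 + (-1/4) * e15 + (-1/4) * e20 + (1/4) * e28 + (1/4) * e33 + (1/2) * e36 + (-1/4) * e37 + (-1/2) * e38 + (-1/2) * e42 + (1/4) * e43 + (-1/4) * e44
  · change f (7, 1) = 0
    linear_combination (1/4) * e5 + (1/4) * e15 + (1/4) * e20 + (-1/4) * e28 + (-1/4) * e33 + (-1/4) * e37 + (-1/2) * e38 + (1/2) * e42 + (-1/4) * e43 + (1/4) * e44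
  · change f (7, 2) = 0
    linear_combination (-1/4) * e5 + (-1/4) * e15 + (-3/4) * e20 + (1/4) * e28 + (1/4) * e33 + (-1/4) * e37 + (-1/2) * e38 + (-1/2) * e42 + (1/4) * e43 + (-1/4) * e44 + (-1/2) * e51 + (-1/2) * e58
  · change f (7, 3) = 0
    linear_combination (1/2) * e4 + (-2) * e12 + (-1) * e13 + (1/2) * e14 + (1/2) * e29 + (-1/2) * e30 + (1) * e31 + (-1/2) * e50 + (-1/2) * e59
  · change f (7, 4) = 0
    linear_combination (-2) * e6 + (-1/2) * e22 + (-1) * e26 + (1) * e46 + (1/2) * e53 + (-1/2) * e54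
  · change f (7, 5) = 0
    linear_combination (-1/4) * e0 + (1/4) * e1 + (1/4) * e2
  · change f (8, 0) = 0
    linear_combination (-1/4) * e4 + (-1/4) * e14 + (-1/4) * e21 + (-1/4) * e29 + (-1/4) * e30 + (-1/4) * e48 + (1/4) * e49 + (1/4) * e50
  · change f (8, 1) = 0
    linear_combination (1/4) * e4 + (1/4) * e14 + (1/4) * e21 + (1/4) * e29 + (-1/4) * e30 + (1/2) * e31 + (1) * e32 + (1/4) * e48 + (-1/4) * e49 + (-1/4) * e50
  · change f (8, 2) = 0
    linear_combination (1/4) * e4 + (3/4) * e14 + (1/4) * e21 + (1/4) * e29 + (-1/4) * e30 + (2) * e32 + (-1/2) * e45 + (1/4) * e48 + (-1/4) * e49 + (-1/4) * e50 + (1/2) * e59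
  · change f (8, 3) = 0
    linear_combination (-1/2) * e5 + (1) * e18 + (-1) * e19 + (-1/2) * e20 + (1/2) * e28 + (1/2) * e37 + (1) * e38 + (-1/2) * e44 + (1/2) * e58
  · change f (8, 4) = 0
    linear_combination (-1/4) * e0 + (1/4) * e1 + (-1/4) * e2
  · change f (8, 5) = 0
    linear_combination (1) * e7 + (1/2) * e17 + (-1) * e25 + (-1) * e26 + (-1/2) * e35 + (1/2) * e46 + (1) * e53 + (1/2) * e55 + (-1) * e56
  · change f (9, 0) = 0
    linear_combination (1/4) * e3 + (3/2) * e6 + (1/4) * e7 + (1/4) * e17 + (1/4) * e22 + (1/4) * e24 + (-1/4) * e35 + (-1/2) * e46 + (1/4) * e54 + (1/4) * e55 + (-1/2) * e56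
  · change f (9, 1) = 0
    linear_combination (1/4) * e3 + (1/2) * e6 + (3/4) * e7 + (1/4) * e17 + (1/4) * e22 + (-1/4) * e24 + (-1) * e25 + (-1/4) * e35 + (1/2) * e53 + (1/4) * e54 + (1/4) * e55 + (-1/2) * e56
  · change f (9, 2) = 0
    linear_combination (1/4) * e3 + (3/2) * e6 + (5/4) * e7 + (-1/2) * e8 + (1/4) * e17 + (1/4) * e22 + (-1/4) * e24 + (-1) * e25 + (-1/4) * e35 + (1/2) * e53 + (1/4) * e54 + (1/4) * e55 + (-1/2) * e56
  · change f (9, 3) = 0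
    linear_combination (1/4) * e0 + (1/4) * e1 + (-1/4) * e2
  · change f (9, 4) = 0
    linear_combination (1) * e18 + (-1) * e19 + (1/2) * e28 + (1) * e37 + (2) * e38 + (-1/2) * e44 + (1/2) * e51 + (1) * e58
  · change f (9, 5) = 0
    linear_combination (2) * e12 + (1) * e13 + (-1/2) * e29 + (-1) * e31 + (2) * e32 + (-1/2) * e45 + (1/2) * e50 + (1) * e59

theorem mrank_add_le {m n : Type} [Fintype m] [Fintype n] (A B : Matrix m n ℂ) :
    (A + B).rank ≤ A.rank + B.rank := by
  unfold Matrix.rank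
  rw [Matrix.mulVecLin_add]
  refine le_trans (Submodule.finrank_mono (t := LinearMap.range A.mulVecLin ⊔
    LinearMap.range B.mulVecLin) ?_) (Submodule.finrank_add_le_finrank_add_finrank _ _)
  rintro _ ⟨x, rfl⟩
  exact Submodule.add_mem_sup ⟨x, rfl⟩ ⟨x, rfl⟩

theorem mrank_sum_le {m n : Type} [Fintype m] [Fintype n] {r : ℕ} (A : Fin r → Matrix m n ℂ)
    (k : ℕ) (h : ∀ i, (A i).rank ≤ k) : (∑ i, A i).rank ≤ r * k := by
  induction r with
  | zero => simp
  | succ r ih =>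
    rw [Fin.sum_univ_succ]
    have h1 := mrank_add_le (A 0) (∑ i : Fin r, A i.succ)
    have h2 := ih (fun i => A i.succ) (fun i => h _)
    have h3 := h 0
    rw [Nat.add_mul]
    omega

/-- Koszul matrix of wedging with `v`, from 2-forms to 3-forms in 5 variables. -/
def kMat (v : Fin 5 → ℂ) : Matrix (Fin 10) (Fin 10) ℂ := fun i j => kSgn i j * v (kIdx i j)

/-- Wedging with `v` from 1-forms to 2-forms. -/
def wMat (v : Fin 5 → ℂ) : Matrix (Fin 10) (Fin 5) ℂ := fun r j =>
  (if j = qIdx r then v (pIdx r) else 0) - (if j = pIdx r then v (qIdx r) else 0)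

/-- Contraction with the `k`-th coordinate vector. -/
def cMat (k : Fin 5) : Matrix (Fin 5) (Fin 10) ℂ := fun j r =>
  (if k = pIdx r ∧ j = qIdx r then 1 else 0) - (if k = qIdx r ∧ j = pIdx r then 1 else 0)

theorem kMat_mul_wMat (v : Fin 5 → ℂ) : kMat v * wMat v = 0 := by
  ext i j
  fin_cases i <;> fin_cases j <;>
    simp [Matrix.mul_apply, Fin.sum_univ_succ, kMat, wMat, kSgn, kIdx, pIdx, qIdx] <;> ring

set_option maxHeartbeats 4000000 in
theorem cMat_mul_wMat (v : Fin 5 → ℂ) (k : Fin 5) :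
    v k • (1 : Matrix (Fin 5) (Fin 5) ℂ) =
      cMat k * wMat v + Matrix.vecMulVec v (Pi.single k 1) := by
  ext i j
  fin_cases k <;> fin_cases i <;> fin_cases j <;>
    simp [Matrix.mul_apply, Fin.sum_univ_succ, cMat, wMat, pIdx, qIdx, Matrix.vecMulVec_apply]

theorem rank_kMat_le (v : Fin 5 → ℂ) : (kMat v).rank ≤ 6 := by
  by_cases hv : v = 0
  · have : kMat v = 0 := by
      ext i j
      simp [kMat, hv]
    rw [this, Matrix.rank_zero]
    omega
  · obtain ⟨k, hk⟩ := Function.ne_iff.mp hv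
    have h1 : (v k • (1 : Matrix (Fin 5) (Fin 5) ℂ)).rank = 5 := by
      rw [Matrix.rank_of_det_ne_zero]
      · simp
      · simpa using hk
    have h2 := Matrix.rank_add_rank_le_card_of_mul_eq_zero (kMat_mul_wMat v)
    rw [cMat_mul_wMat] at h1
    have h3 := mrank_add_le (cMat k * wMat v) (Matrix.vecMulVec v (Pi.single k 1))
    have h4 := Matrix.rank_mul_le_right (cMat k) (wMat v)
    have h5 := Matrix.rank_vecMulVec_le v (Pi.single k (1 : ℂ))
    simp only [Fintype.card_fin] at h2
    omega

/-- The contribution of a single cube to the Koszul flattening. -/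
def bigMat (v : Fin 5 → ℂ) (w : Fin 6 → ℂ) : Matrix (Fin 10 × Fin 6) (Fin 10 × Fin 6) ℂ :=
  fun p q => kSgn p.1 q.1 * (v (kIdx p.1 q.1) * w p.2 * w q.2)

theorem rank_bigMat_le (v : Fin 5 → ℂ) (w : Fin 6 → ℂ) : (bigMat v w).rank ≤ 6 := by
  have h : bigMat v w = (Matrix.of fun (p : Fin 10 × Fin 6) (i : Fin 10) =>
      if p.1 = i then w p.2 else 0) * (kMat v * (Matrix.of fun (i : Fin 10)
        (p : Fin 10 × Fin 6) => if p.1 = i then w p.2 else 0)) := by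
    ext p q
    simp [Matrix.mul_apply, bigMat, kMat]
    ring
  rw [h]
  exact (Matrix.rank_mul_le_right _ _).trans ((Matrix.rank_mul_le_left _ _).trans (rank_kMat_le v))

/-- The limit of the Koszul flattenings. -/
def limMat : Matrix (Fin 10 × Fin 6) (Fin 10 × Fin 6) ℂ :=
  fun p q => kSgn p.1 q.1 * tTab (kIdx p.1 q.1) p.2 q.2

/-- A correction of rank five. -/
def corMat : Matrix (Fin 10 × Fin 6) (Fin 10 × Fin 6) ℂ :=
  Matrix.diagonal fun p => rTab p.1 p.2

theorem rank_corMat_le : corMat.rank ≤ 5 := by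
  classical
  rw [corMat, Matrix.rank_diagonal, Fintype.card_subtype]
  refine (Finset.card_le_card (t := rSet) ?_).trans (by decide)
  intro p hp
  by_contra h
  exact (Finset.mem_filter.mp hp).2 (if_neg h)

theorem det_ne : (limMat + corMat).det ≠ 0 := by
  intro h
  obtain ⟨f, hf, h0⟩ := Matrix.exists_mulVec_eq_zero_iff.mpr h
  apply hf
  apply inj_aux
  intro i a
  have := congrFun h0 (i, a)
  rw [Matrix.add_mulVec] at this
  simpa [corMat, Matrix.mulVec_diagonal, Matrix.mulVec, dotProduct, limMat,
    Fintype.sum_prod_type, Matrix.diagonal_apply] using this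

/-- The cubic in coordinates. -/
def pc (c : Fin 6 → ℂ) : ℂ :=
  c 0 ^ 3 + c 1 ^ 3 + c 2 ^ 3 + 3 * c 0 * (c 3 ^ 2 + c 4 ^ 2) + 3 * c 1 * (c 3 ^ 2 + c 5 ^ 2)
    + 3 * c 2 * (c 4 ^ 2 + c 5 ^ 2) + 6 * c 3 * c 4 * c 5

/-- Twice the polarization of the cubic. -/
def tri (u x y : Fin 6 → ℂ) : ℂ :=
  2 * (u 0 * x 0 * y 0
    + u 1 * x 1 * y 1
    + u 2 * x 2 * y 2
    + (u 0 * x 3 * y 3 + u 3 * x 0 * y 3 + u 3 * x 3 * y 0)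
    + (u 0 * x 4 * y 4 + u 4 * x 0 * y 4 + u 4 * x 4 * y 0)
    + (u 1 * x 3 * y 3 + u 3 * x 1 * y 3 + u 3 * x 3 * y 1)
    + (u 1 * x 5 * y 5 + u 5 * x 1 * y 5 + u 5 * x 5 * y 1)
    + (u 2 * x 4 * y 4 + u 4 * x 2 * y 4 + u 4 * x 4 * y 2)
    + (u 2 * x 5 * y 5 + u 5 * x 2 * y 5 + u 5 * x 5 * y 2)
    + u 3 * x 4 * y 5
    + u 3 * x 5 * y 4
    + u 4 * x 3 * y 5
    + u 4 * x 5 * y 3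
    + u 5 * x 3 * y 4
    + u 5 * x 4 * y 3)

theorem tri_eq (u x y : Fin 6 → ℂ) :
    tri u x y = (1 / 12) * (pc (u + x + y) - pc (u + x - y) - pc (u - x + y)
      - pc (-u + x + y)) := by
  simp only [tri, pc, Pi.add_apply, Pi.sub_apply, Pi.neg_apply]
  ring

/-- Coordinate vectors. -/
def eVec (a : Fin 6) : Fin 6 → ℂ := fun j => if j = a then 1 else 0

set_option maxHeartbeats 4000000 in
theorem tTab_eq (k : Fin 5) (a b : Fin 6) : tTab k a b = tri (uVec k) (eVec a) (eVec b) := by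
  fin_cases k <;> fin_cases a <;> fin_cases b <;>
    simp [tTab, tri, uVec, eVec] <;> norm_num

theorem lower {r : ℕ} (l : ℕ → Fin r → ((Fin 6 → ℂ) →ₗ[ℂ] ℂ))
    (h : ∀ c, Tendsto (fun m => ∑ i, (l m i c) ^ 3) atTop (nhds (pc c))) : 10 ≤ r := by
  have hT : ∀ k a b, Tendsto (fun m => ∑ i, 2 * l m i (uVec k) * l m i (eVec a)
      * l m i (eVec b)) atTop (nhds (tTab k a b)) := by
    intro k a b
    rw [tTab_eq, tri_eq]
    refine Tendsto.congr ?_ ((((h (uVec k + eVec a + eVec b)).sub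
      (h (uVec k + eVec a - eVec b))).sub
      (h (uVec k - eVec a + eVec b))).sub
      (h (-uVec k + eVec a + eVec b))|>.const_mul (1 / 12))
    intro m
    simp only [← Finset.sum_sub_distrib, Finset.mul_sum]
    refine Finset.sum_congr rfl fun i _ => ?_
    simp only [map_add, map_sub, map_neg]
    ring
  set Mm : ℕ → Matrix (Fin 10 × Fin 6) (Fin 10 × Fin 6) ℂ := fun m =>
    ∑ i, bigMat (fun k => 2 * l m i (uVec k)) (fun a => l m i (eVec a)) with hMm
  have hlim : Tendsto Mm atTop (nhds limMat) := by
    refine tendsto_pi_nhds.2 fun p => tendsto_pi_nhds.2 fun q => ?_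
    refine Tendsto.congr ?_ ((hT (kIdx p.1 q.1) p.2 q.2).const_mul (kSgn p.1 q.1))
    intro m
    simp [hMm, Matrix.sum_apply, bigMat, Finset.mul_sum]
  have hdet : Tendsto (fun m => (Mm m + corMat).det) atTop (nhds (limMat + corMat).det) := by
    have hc : Continuous fun A : Matrix (Fin 10 × Fin 6) (Fin 10 × Fin 6) ℂ =>
        (A + corMat).det := (continuous_id.add continuous_const).matrix_det
    exact (hc.tendsto limMat).comp hlim
  obtain ⟨m, hm⟩ := (hdet.eventually_ne det_ne).exists
  have h1 := Matrix.rank_of_det_ne_zero hm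
  have h2 := mrank_add_le (Mm m) corMat
  have h3 := mrank_sum_le (fun i => bigMat (fun k => 2 * l m i (uVec k))
    (fun a => l m i (eVec a))) 6 (fun i => rank_bigMat_le _ _)
  have h4 := rank_corMat_le
  have h5 : (Mm m).rank ≤ r * 6 := h3
  simp only [Fintype.card_prod, Fintype.card_fin] at h1
  omega

/-- Coordinates on symmetric matrices. -/
def symCoord : (Fin 6 → ℂ) →ₗ[ℂ] symMat 3 where
  toFun c := ⟨!![c 0, c 3, c 4; c 3, c 1, c 5; c 4, c 5, c 2], by
    change _ᵀ = _
    ext i j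
    fin_cases i <;> fin_cases j <;> rfl⟩
  map_add' c d := by
    ext i j
    fin_cases i <;> fin_cases j <;> rfl
  map_smul' t c := by
    ext i j
    fin_cases i <;> fin_cases j <;> rfl

theorem sMS_symCoord (c : Fin 6 → ℂ) : sMS 3 (symCoord c) = pc c := by
  simp [sMS, symCoord, pc, pow_succ, Matrix.trace_fin_three, Matrix.mul_apply, Fin.sum_univ_three]
  ring

theorem exists_symCoord (A : symMat 3) : ∃ c, symCoord c = A := by
  have hA : (A : Matrix (Fin 3) (Fin 3) ℂ)ᵀ = A := A.2
  have h : ∀ i j, A.1 i j = A.1 j i := fun i j => congrFun (congrFun hA j) i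
  refine ⟨![A.1 0 0, A.1 1 1, A.1 2 2, A.1 0 1, A.1 0 2, A.1 1 2], ?_⟩
  ext i j
  fin_cases i <;> fin_cases j <;> first | rfl | exact h _ _

/-- Matrix entry as a linear form. -/
def ent (i j : Fin 3) : Matrix (Fin 3) (Fin 3) ℂ →ₗ[ℂ] ℂ := Matrix.entryLinearMap ℂ ℂ i j

/-- Linear form on symmetric matrices with given coefficients. -/
def lform (s t0 t1 t2 t3 t4 t5 : ℂ) : symMat 3 →ₗ[ℂ] ℂ :=
  s • (t0 • ent 0 0 + t1 • ent 1 1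
    + t2 • ent 2 2 + t3 • ent 0 1
    + t4 • ent 0 2 + t5 • ent 1 2).comp
      (symMat 3).subtype

theorem lform_symCoord (s t0 t1 t2 t3 t4 t5 : ℂ) (c : Fin 6 → ℂ) :
    lform s t0 t1 t2 t3 t4 t5 (symCoord c) =
      s * (t0 * c 0 + t1 * c 1 + t2 * c 2 + t3 * c 3 + t4 * c 4 + t5 * c 5) := by
  simp [lform, symCoord, ent]

theorem upper : ∃ l : ℕ → Fin 10 → (symMat 3 →ₗ[ℂ] ℂ),
    ∀ a, Tendsto (fun m => ∑ i, (l m i a) ^ 3) atTop (nhds (sMS 3 a)) := by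
  have hcr : ∀ x : ℂ, ∃ y : ℂ, y ^ 3 = x := fun x => IsAlgClosed.exists_pow_nat_eq x (by norm_num)
  choose cr hcr using hcr
  obtain ⟨r, hr⟩ : ∃ r : ℂ, r ^ 2 = 2 := IsAlgClosed.exists_pow_nat_eq 2 (by norm_num)
  obtain ⟨e, he0, helim⟩ : ∃ e : ℕ → ℂ, (∀ m, e m ≠ 0) ∧ Tendsto e atTop (nhds 0) :=
    ⟨fun m => 1 / ((m : ℂ) + 1), fun m => one_div_ne_zero (Nat.cast_add_one_ne_zero m),
      tendsto_one_div_add_atTop_nhds_zero_nat⟩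
  refine ⟨fun m => ![
    lform (cr (1 / 16)) 1 1 0 2 r r,
    lform (cr (1 / 16)) 1 1 0 2 (-r) (-r),
    lform (cr (1 / 16)) 1 1 0 (-2) r (-r),
    lform (cr (1 / 16)) 1 1 0 (-2) (-r) r,
    lform (cr (1 / 4)) (1 / 2) (-1 / 2) 1 0 r 0,
    lform (cr (1 / 4)) (1 / 2) (-1 / 2) 1 0 (-r) 0,
    lform (cr (1 / 4)) (-1 / 2) (1 / 2) 1 0 0 r,
    lform (cr (1 / 4)) (-1 / 2) (1 / 2) 1 0 0 (-r),
    lform (cr (1 / (4 * e m))) (1 + e m) (-1 + e m) (-e m) 0 0 0,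
    lform (cr (-1 / (4 * e m))) 1 (-1) 0 0 0 0], ?_⟩
  intro a
  obtain ⟨c, rfl⟩ := exists_symCoord a
  rw [sMS_symCoord]
  have key : Tendsto (fun m => pc c + (3 * (c 0 - c 1) * (c 0 + c 1 - c 2) ^ 2 * e m
      + (c 0 + c 1 - c 2) ^ 3 * (e m * e m)) / 4) atTop (nhds (pc c + (3 * (c 0 - c 1) *
      (c 0 + c 1 - c 2) ^ 2 * 0 + (c 0 + c 1 - c 2) ^ 3 * (0 * 0)) / 4)) :=
    tendsto_const_nhds.add (((helim.const_mul _).add ((helim.mul helim).const_mul _)).div_const 4)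
  rw [show pc c + (3 * (c 0 - c 1) * (c 0 + c 1 - c 2) ^ 2 * 0
    + (c 0 + c 1 - c 2) ^ 3 * (0 * 0)) / 4 = pc c by ring] at key
  refine key.congr fun m => ?_
  have h0 := he0 m
  beta_reduce
  generalize e m = t at h0 ⊢
  have h1 : 1 / (4 * t) * (c 0 - c 1 + t * (c 0 + c 1 - c 2)) ^ 3
      + -1 / (4 * t) * (c 0 - c 1) ^ 3 = (3 * (c 0 - c 1) ^ 2 * (c 0 + c 1 - c 2)
      + 3 * (c 0 - c 1) * (c 0 + c 1 - c 2) ^ 2 * t + (c 0 + c 1 - c 2) ^ 3 * (t * t)) / 4 := by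
    field_simp
    ring
  simp only [Fin.sum_univ_succ, lform_symCoord, mul_pow, hcr, Matrix.cons_val_zero,
    Matrix.cons_val_succ, Finset.univ_eq_empty, Finset.sum_empty]
  simp only [pc]
  linear_combination -h1 - (3 / 4 * (c 0 + c 1) * (c 4 ^ 2 + c 5 ^ 2) + 3 * c 3 * c 4 * c 5
    + 3 / 2 * ((c 0 / 2 - c 1 / 2 + c 2) * c 4 ^ 2 + (c 1 / 2 - c 0 / 2 + c 2) * c 5 ^ 2)) * hr

end

theorem symBorderRank_sMS3 : symBorderRank (sMS 3) = 10 := by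
  unfold symBorderRank
  apply le_antisymm
  · exact Nat.sInf_le upper
  · refine le_csInf ⟨10, upper⟩ ?_
    rintro r ⟨l, hl⟩
    refine lower (fun m i => (l m i).comp symCoord) fun c => ?_
    have := hl (symCoord c)
    rw [sMS_symCoord] at this
    exact this
end
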